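/- Let s = 2k+1 with k ≥ 1, K ∈ 𝒦_s, and μ ∈ ℱ_s([0,1], λ). Then there exists a constant C > 0 such that for all h ∈ (0,1) and all t ∈ (h, 1-h), | κ_h(t, μ) - h^{-2} K₁((λ - t)/h) [μ'](λ) | ≤ C h^{s-3}, where K₁ is extended by 0 outside [-1,1]. In particular κ_h(t, μ) = O(h^{-2}) when |λ - t| < h, and κ_h(t, μ) = O(h^{s-3}) when |λ - t| ≥ h. -/

import Mathlib

open MeasureTheory ProbabilityTheory Filter Set Topology

noncomputable section

/-- Normalising constant `a_k` of the kink-detection kernel. -/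
def kinkA (k : ℕ) : ℝ :=
  (Nat.factorial (4*k+5) : ℝ) /
    (2^(4*k+5) * (Nat.factorial (2*k) : ℝ) * (Nat.factorial (2*k+2) : ℝ))

/-- Polynomial coefficients `b_{j,k}` of the kink-detection kernel. -/
def kinkB (j k : ℕ) : ℝ :=
  ((-1 : ℝ)^(k+j+1) * (Nat.factorial (2*j) : ℝ)) /
    ((Nat.factorial j : ℝ) * (Nat.factorial (2*k+2-j) : ℝ) *
      (Nat.factorial (2*j+2-2*k) : ℝ))

/-- The polynomial part of the kernel `K ∈ 𝒦_{2k+1}`. -/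
def kinkPoly (k : ℕ) : ℝ → ℝ := fun x =>
  kinkA k * ∑ j ∈ Finset.Icc (k-1) (2*k+2), kinkB j k * x ^ (2*j+2-2*k)

/-- `Kd k i` is the `i`-th derivative of the polynomial part of the kernel. -/
def Kd (k i : ℕ) : ℝ → ℝ := iteratedDeriv i (kinkPoly k)

/-- `Kde k i` is the `i`-th derivative of the polynomial part of the kernel,
extended by `0` outside `[-1,1]`. -/
def Kde (k i : ℕ) : ℝ → ℝ := fun x => if x ∈ Set.Icc (-1:ℝ) 1 then Kd k i x else 0

/-- The smoothed third derivative `κ_h(t, μ) = h⁻⁴ ∫₀¹ K₃((x-t)/h) μ(x) dx`. -/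
def kappah (k : ℕ) (h t : ℝ) (μ : ℝ → ℝ) : ℝ :=
  (h^4)⁻¹ * ∫ x in (0:ℝ)..1, Kde k 3 ((x - t)/h) * μ x

/-- The class `ℱ_s(λ)`: a kink of size `a_μ ≠ 0` in the first derivative at `λ`,
with `s`-smooth one-sided extensions whose derivatives of orders `2,…,s-1` match at `λ`. -/
def MemF (s : ℕ) (lam : ℝ) (μ : ℝ → ℝ) : Prop :=
  ∃ gm gp : ℝ → ℝ, ContDiff ℝ (s : ℕ∞) gm ∧ ContDiff ℝ (s : ℕ∞) gp ∧
    (∀ x ≤ lam, μ x = gm x) ∧ (∀ x, lam ≤ x → μ x = gp x) ∧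
    deriv gp lam - deriv gm lam ≠ 0 ∧
    ∀ i, 2 ≤ i → i ≤ s - 1 → iteratedDeriv i gp lam = iteratedDeriv i gm lam

/-- The no-kink class `𝒢_s`. -/
def MemG (s : ℕ) (μ : ℝ → ℝ) : Prop := ContDiff ℝ (s : ℕ∞) μ

/-- A slowly varying function. -/
def SlowlyVarying (L : ℝ → ℝ) : Prop :=
  (∀ x, 0 < x → 0 < L x) ∧
    ∀ c : ℝ, 0 < c → Tendsto (fun x : ℝ => L (c * x) / L x) atTop (𝓝 1)

/-- Coefficients of the causal LRD linear process. -/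
def lrdCoef (α : ℝ) (L : ℝ → ℝ) : ℕ → ℝ := fun i =>
  if i = 0 then 1 else (i : ℝ) ^ (-((1 + α) / 2)) * L i

/-- The filtration `ℱ_i = σ(…, η_{i-1}, η_i)` generated by the innovations. -/
def lrdFilt {Ω : Type*} [MeasurableSpace Ω] (η : ℤ → Ω → ℝ) (i : ℤ) : MeasurableSpace Ω :=
  ⨆ j : ℤ, ⨆ _ : j ≤ i, MeasurableSpace.comap (η j) (inferInstance : MeasurableSpace ℝ)


/-- Iterated integration by parts: `F (i + 1)` is an antiderivative of `F i`, and `G (i + 1)` is the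
derivative of `G i`. -/
theorem integral_mul_eq_sum_add_integral {F G : ℕ → ℝ → ℝ} {n : ℕ}
    (hF : ∀ i < n, ∀ x, HasDerivAt (F (i + 1)) (F i x) x)
    (hG : ∀ i < n, ∀ x, HasDerivAt (G i) (G (i + 1) x) x)
    (hFc : ∀ i ≤ n, Continuous (F i)) (hGc : ∀ i ≤ n, Continuous (G i)) (a b : ℝ) :
    ∫ x in a..b, F 0 x * G 0 x =
      (∑ i ∈ Finset.range n, (-1) ^ i * (F (i + 1) b * G i b)) -
        (∑ i ∈ Finset.range n, (-1) ^ i * (F (i + 1) a * G i a)) +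
          (-1) ^ n * ∫ x in a..b, F n x * G n x := by
  induction n with
  | zero => simp
  | succ n ih =>
    rw [ih (fun i hi => hF i (by lia)) (fun i hi => hG i (by lia)) (fun i hi => hFc i (by lia))
      (fun i hi => hGc i (by lia)), Finset.sum_range_succ, Finset.sum_range_succ]
    have key := intervalIntegral.integral_mul_deriv_eq_deriv_mul (a := a) (b := b)
      (fun x _ => hG n (by lia) x) (fun x _ => hF n (by lia) x)
      ((hGc (n + 1) le_rfl).intervalIntegrable a b) ((hFc n (by lia)).intervalIntegrable a b)
    simp only [mul_comm (G _ _)] at key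
    rw [key]
    ring

/-- The polynomial `c (1 - X²)^(2k+2)` whose derivative of order `2k-2` is the kernel. -/
def kinkPotential (k : ℕ) : Polynomial ℝ :=
  Polynomial.C (kinkA k * ((-1) ^ (k + 1) / (Nat.factorial (2 * k + 2) : ℝ))) *
    (1 - Polynomial.X ^ 2) ^ (2 * k + 2)

theorem kinkPoly_eq_eval {k : ℕ} (hk : 1 ≤ k) :
    kinkPoly k = fun x => (Polynomial.derivative^[2 * k - 2] (kinkPotential k)).eval x := by
  funext x
  have hexp : ((1 : Polynomial ℝ) - Polynomial.X ^ 2) ^ (2 * k + 2) =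
      ∑ j ∈ Finset.range (2 * k + 2 + 1),
        Polynomial.C ((-1 : ℝ) ^ j * ((2 * k + 2).choose j : ℝ)) * Polynomial.X ^ (2 * j) := by
    rw [sub_eq_neg_add, add_pow]
    refine Finset.sum_congr rfl fun j _ => ?_
    simp only [neg_pow (Polynomial.X ^ 2 : Polynomial ℝ), one_pow, mul_one, map_mul, map_pow,
      map_neg, map_one, map_natCast, pow_mul]
    ring
  rw [kinkPotential, Polynomial.iterate_derivative_C_mul, hexp, Polynomial.iterate_derivative_sum]
  simp only [Polynomial.iterate_derivative_C_mul, Polynomial.iterate_derivative_X_pow_eq_smul,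
    Polynomial.eval_mul, Polynomial.eval_C, Polynomial.eval_finsetSum, Polynomial.eval_smul,
    Polynomial.eval_pow, Polynomial.eval_X, smul_eq_mul]
  rw [kinkPoly, mul_assoc]
  congr 1
  rw [Finset.mul_sum]
  have hsubset : Finset.Icc (k - 1) (2 * k + 2) ⊆ Finset.range (2 * k + 2 + 1) := by
    intro j hj
    simp only [Finset.mem_Icc, Finset.mem_range] at hj ⊢
    lia
  refine Eq.trans ?_ (Finset.sum_subset hsubset ?_)
  · refine Finset.sum_congr rfl fun j hj => ?_
    rw [Finset.mem_Icc] at hj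
    have h1 : 2 * j - (2 * k - 2) = 2 * j + 2 - 2 * k := by lia
    have h2 : (Nat.factorial (2 * j) : ℝ) =
        Nat.factorial (2 * j + 2 - 2 * k) * (Nat.descFactorial (2 * j) (2 * k - 2) : ℝ) := by
      rw [← h1]
      exact_mod_cast (Nat.factorial_mul_descFactorial (by lia)).symm
    have h3 : (Nat.factorial (2 * k + 2) : ℝ) =
        (Nat.choose (2 * k + 2) j) * Nat.factorial j * Nat.factorial (2 * k + 2 - j) := by
      exact_mod_cast (Nat.choose_mul_factorial_mul_factorial hj.2).symm
    have h4 : (Nat.choose (2 * k + 2) j : ℝ) ≠ 0 := by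
      exact_mod_cast (Nat.choose_pos hj.2).ne'
    have h5 : ∀ m : ℕ, (Nat.factorial m : ℝ) ≠ 0 := fun m => by
      exact_mod_cast Nat.factorial_ne_zero m
    rw [h1, kinkB, h2, h3]
    have := h5 j
    have := h5 (2 * k + 2 - j)
    have := h5 (2 * j + 2 - 2 * k)
    field_simp
    ring
  · intro j hj hj'
    simp only [Finset.mem_Icc, Finset.mem_range] at hj hj'
    rw [Nat.descFactorial_of_lt (by lia)]
    simp

theorem iteratedDeriv_polynomial_eval (p : Polynomial ℝ) (i : ℕ) :
    iteratedDeriv i (fun x => p.eval x) = fun x => (Polynomial.derivative^[i] p).eval x := by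
  induction i with
  | zero => simp
  | succ i ih =>
    rw [iteratedDeriv_succ, ih]
    funext x
    rw [Polynomial.deriv, Function.iterate_succ_apply']

theorem Kd_eq_eval {k : ℕ} (hk : 1 ≤ k) (i : ℕ) :
    Kd k i = fun x => (Polynomial.derivative^[2 * k - 2 + i] (kinkPotential k)).eval x := by
  rw [Kd, kinkPoly_eq_eval hk, iteratedDeriv_polynomial_eval]
  funext x
  rw [← Function.iterate_add_apply, add_comm]

theorem eval_iterate_derivative_kinkPotential_eq_zero {k i : ℕ} (hi : i < 2 * k + 2) {x : ℝ}
    (hx : x ^ 2 = 1) : (Polynomial.derivative^[i] (kinkPotential k)).eval x = 0 := by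
  rw [kinkPotential, Polynomial.iterate_derivative_C_mul]
  obtain ⟨q, hq⟩ := Polynomial.pow_sub_dvd_iterate_derivative_pow
    ((1 : Polynomial ℝ) - Polynomial.X ^ 2) (2 * k + 2) i
  rw [hq]
  simp [hx, Nat.sub_ne_zero_of_lt hi]

theorem exists_abs_eval_le (p : Polynomial ℝ) :
    ∃ B > 0, ∀ x ∈ Set.Icc (-1 : ℝ) 1, |p.eval x| ≤ B := by
  obtain ⟨B, hB⟩ := isCompact_Icc.exists_bound_of_continuousOn
    (s := Set.Icc (-1 : ℝ) 1) p.continuous.continuousOn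
  exact ⟨max B 1, by positivity, fun x hx => (hB x hx).trans (le_max_left _ _)⟩

/-- The rescaled iterated antiderivatives of `x ↦ K₃((x - t) / h)`. -/
def kinkAntideriv (k : ℕ) (h t : ℝ) (i : ℕ) (x : ℝ) : ℝ :=
  h ^ i * (Polynomial.derivative^[2 * k + 1 - i] (kinkPotential k)).eval ((x - t) / h)

theorem hasDerivAt_kinkAntideriv (k : ℕ) {h : ℝ} (hh : h ≠ 0) (t : ℝ) {i : ℕ}
    (hi : i < 2 * k + 1) (x : ℝ) :
    HasDerivAt (kinkAntideriv k h t (i + 1)) (kinkAntideriv k h t i x) x := by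
  have h1 : HasDerivAt (fun x => (x - t) / h) (1 / h) x :=
    ((hasDerivAt_id x).sub_const t).div_const h
  have h2 := (((Polynomial.derivative^[2 * k + 1 - (i + 1)] (kinkPotential k)).hasDerivAt
    ((x - t) / h)).comp x h1).const_mul (h ^ (i + 1))
  refine h2.congr_deriv ?_
  rw [← Function.iterate_succ_apply' Polynomial.derivative, kinkAntideriv,
    show (2 * k + 1 - (i + 1)).succ = 2 * k + 1 - i by lia]
  field_simp
  ring

theorem continuous_kinkAntideriv (k : ℕ) (h t : ℝ) (i : ℕ) :
    Continuous (kinkAntideriv k h t i) :=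
  continuous_const.mul (by fun_prop)

/-- Boundary terms produced by iterated integration by parts against `K₃((x - t) / h)`. -/
def kinkBoundary (k : ℕ) (h t : ℝ) (g : ℝ → ℝ) (x : ℝ) : ℝ :=
  ∑ i ∈ Finset.range (2 * k + 1), (-1) ^ i * (kinkAntideriv k h t (i + 1) x * iteratedDeriv i g x)

theorem integral_kinkAntideriv_mul (k : ℕ) {h : ℝ} (hh : h ≠ 0) (t : ℝ) {g : ℝ → ℝ}
    (hg : ContDiff ℝ ((2 * k + 1 : ℕ) : ℕ∞) g) (a b : ℝ) :
    ∫ x in a..b, kinkAntideriv k h t 0 x * g x =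
      kinkBoundary k h t g b - kinkBoundary k h t g a + (-1) ^ (2 * k + 1) *
        ∫ x in a..b, kinkAntideriv k h t (2 * k + 1) x * iteratedDeriv (2 * k + 1) g x := by
  have key := integral_mul_eq_sum_add_integral (F := kinkAntideriv k h t)
    (G := fun i => iteratedDeriv i g) (n := 2 * k + 1)
    (fun i hi x => hasDerivAt_kinkAntideriv k hh t hi x)
    (fun i hi x => by
      rw [iteratedDeriv_succ]
      exact (hg.differentiable_iteratedDeriv i (by exact_mod_cast hi) x).hasDerivAt)
    (fun i _ => continuous_kinkAntideriv k h t i)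
    (fun i hi => hg.continuous_iteratedDeriv i (by exact_mod_cast hi)) a b
  simpa [kinkBoundary] using key

theorem kinkBoundary_eq_zero (k : ℕ) (h t : ℝ) (g : ℝ → ℝ) {x : ℝ} (hx : ((x - t) / h) ^ 2 = 1) :
    kinkBoundary k h t g x = 0 := by
  refine Finset.sum_eq_zero fun i _ => ?_
  rw [kinkAntideriv, eval_iterate_derivative_kinkPotential_eq_zero (by lia) hx]
  simp

theorem kinkBoundary_sub {k : ℕ} (hk : 1 ≤ k) (h t : ℝ) {gm gp : ℝ → ℝ} {x : ℝ}
    (h0 : gm x = gp x)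
    (hhigh : ∀ i, 2 ≤ i → i ≤ 2 * k → iteratedDeriv i gp x = iteratedDeriv i gm x) :
    kinkBoundary k h t gm x - kinkBoundary k h t gp x =
      h ^ 2 * Kd k 1 ((x - t) / h) * (deriv gp x - deriv gm x) := by
  rw [kinkBoundary, kinkBoundary, ← Finset.sum_sub_distrib, Finset.sum_eq_single 1]
  · rw [Kd_eq_eval hk, kinkAntideriv, iteratedDeriv_one, iteratedDeriv_one,
      show 2 * k + 1 - (1 + 1) = 2 * k - 2 + 1 by lia]
    ring
  · intro i hi hi1
    rw [Finset.mem_range] at hi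
    rcases Nat.eq_zero_or_pos i with rfl | hpos
    · simp [h0]
    · rw [hhigh i (by lia) (by lia), sub_self]
  · intro hmem
    exact absurd (Finset.mem_range.2 (by lia)) hmem

theorem abs_integral_kinkAntideriv_mul_le {k : ℕ} {B M h t : ℝ} (hh : 0 < h) {f : ℝ → ℝ}
    (hB : ∀ x ∈ Set.Icc (-1 : ℝ) 1, |(kinkPotential k).eval x| ≤ B)
    {a b : ℝ} (hab : a ≤ b) (ha : t - h ≤ a) (hb : b ≤ t + h)
    (hM : ∀ x ∈ Set.Icc a b, |f x| ≤ M) :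
    |∫ x in a..b, kinkAntideriv k h t (2 * k + 1) x * f x| ≤
      h ^ (2 * k + 1) * B * M * (b - a) := by
  rw [← abs_of_nonneg (sub_nonneg.2 hab), ← Real.norm_eq_abs]
  refine intervalIntegral.norm_integral_le_of_norm_le_const fun x hx => ?_
  rw [Set.uIoc_of_le hab] at hx
  have hBx := hB ((x - t) / h) ⟨by rw [le_div_iff₀ hh]; linarith [hx.1],
    by rw [div_le_iff₀ hh]; linarith [hx.2]⟩
  have hMx := hM x ⟨hx.1.le, hx.2⟩
  rw [Real.norm_eq_abs, abs_mul, kinkAntideriv, abs_mul, abs_of_pos (pow_pos hh _),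
    show 2 * k + 1 - (2 * k + 1) = 0 by lia, Function.iterate_zero_apply]
  have := (abs_nonneg _).trans hBx
  gcongr

theorem Kde_one_eq_zero {k : ℕ} (hk : 1 ≤ k) {u : ℝ} (hu : 1 ≤ |u|) : Kde k 1 u = 0 := by
  rw [Kde]
  split_ifs with hmem
  · have hu1 : |u| = 1 := le_antisymm (abs_le.2 hmem) hu
    rw [Kd_eq_eval hk]
    exact eval_iterate_derivative_kinkPotential_eq_zero (by lia) (by rw [← sq_abs, hu1, one_pow])
  · rfl

theorem kappah_eq {k : ℕ} (hk : 1 ≤ k) {h t : ℝ} (hh : 0 < h) (ht : t ∈ Set.Ioo h (1 - h))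
    (μ : ℝ → ℝ) :
    kappah k h t μ = (h ^ 4)⁻¹ * ∫ x in (t - h)..(t + h), kinkAntideriv k h t 0 x * μ x := by
  rw [kappah, intervalIntegral.integral_of_le zero_le_one,
    intervalIntegral.integral_of_le (by linarith), ← integral_Icc_eq_integral_Ioc (x := t - h)]
  have hind : (fun x => Kde k 3 ((x - t) / h) * μ x) =
      (Set.Icc (t - h) (t + h)).indicator (fun x => kinkAntideriv k h t 0 x * μ x) := by
    funext x
    have hiff : (x - t) / h ∈ Set.Icc (-1 : ℝ) 1 ↔ x ∈ Set.Icc (t - h) (t + h) := by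
      rw [Set.mem_Icc, Set.mem_Icc, le_div_iff₀ hh, div_le_iff₀ hh]
      constructor <;> rintro ⟨h1, h2⟩ <;> constructor <;> linarith
    by_cases hx : x ∈ Set.Icc (t - h) (t + h)
    · rw [Set.indicator_of_mem hx, Kde, if_pos (hiff.2 hx), Kd_eq_eval hk, kinkAntideriv,
        show 2 * k + 1 - 0 = 2 * k - 2 + 3 by lia, pow_zero, one_mul]
    · rw [Set.indicator_of_notMem hx, Kde, if_neg (mt hiff.1 hx), zero_mul]
  rw [hind, setIntegral_indicator measurableSet_Icc, Set.inter_eq_self_of_subset_right]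
  intro x hx
  exact ⟨by linarith [hx.1, ht.1], by linarith [hx.2, ht.2]⟩

theorem abs_integral_sub_le {k : ℕ} (hk : 1 ≤ k) {lam : ℝ} {μ gm gp : ℝ → ℝ}
    (hgm : ContDiff ℝ ((2 * k + 1 : ℕ) : ℕ∞) gm) (hgp : ContDiff ℝ ((2 * k + 1 : ℕ) : ℕ∞) gp)
    (hm : ∀ x ≤ lam, μ x = gm x) (hp : ∀ x, lam ≤ x → μ x = gp x)
    (hhigh : ∀ i, 2 ≤ i → i ≤ 2 * k → iteratedDeriv i gp lam = iteratedDeriv i gm lam)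
    {B M h t : ℝ} (hh : 0 < h) (ht : t ∈ Set.Ioo h (1 - h))
    (hB : ∀ x ∈ Set.Icc (-1 : ℝ) 1, |(kinkPotential k).eval x| ≤ B)
    (hMm : ∀ x ∈ Set.Icc (0 : ℝ) 1, |iteratedDeriv (2 * k + 1) gm x| ≤ M)
    (hMp : ∀ x ∈ Set.Icc (0 : ℝ) 1, |iteratedDeriv (2 * k + 1) gp x| ≤ M) :
    |(∫ x in (t - h)..(t + h), kinkAntideriv k h t 0 x * μ x) -
      h ^ 2 * Kde k 1 ((lam - t) / h) * (deriv gp lam - deriv gm lam)| ≤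
        h ^ (2 * k + 1) * B * M * (2 * h) := by
  have hleft : ∀ g, kinkBoundary k h t g (t - h) = 0 := fun g =>
    kinkBoundary_eq_zero k h t g (by field_simp; ring)
  have hright : ∀ g, kinkBoundary k h t g (t + h) = 0 := fun g =>
    kinkBoundary_eq_zero k h t g (by field_simp; ring)
  have habs : ∀ y : ℝ, |(-1) ^ (2 * k + 1) * y| = |y| := fun y => by simp [abs_mul]
  have hsub : ∀ {x}, x ∈ Set.Icc (t - h) (t + h) → x ∈ Set.Icc (0 : ℝ) 1 := fun hx =>
    ⟨by linarith [hx.1, ht.1], by linarith [hx.2, ht.2]⟩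
  rcases le_or_gt h |lam - t| with hfar | hnear
  · have hsmooth : ∀ g, ContDiff ℝ ((2 * k + 1 : ℕ) : ℕ∞) g →
        (∀ x ∈ Set.Icc (0 : ℝ) 1, |iteratedDeriv (2 * k + 1) g x| ≤ M) →
        (∀ x ∈ Set.Icc (t - h) (t + h), μ x = g x) →
        |∫ x in (t - h)..(t + h), kinkAntideriv k h t 0 x * μ x| ≤
          h ^ (2 * k + 1) * B * M * (2 * h) := by
      intro g hg hMg hμ
      have hcongr : ∫ x in (t - h)..(t + h), kinkAntideriv k h t 0 x * μ x =
          ∫ x in (t - h)..(t + h), kinkAntideriv k h t 0 x * g x := by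
        refine intervalIntegral.integral_congr fun x hx => ?_
        rw [Set.uIcc_of_le (by linarith)] at hx
        simp only [hμ x hx]
      rw [hcongr, integral_kinkAntideriv_mul k hh.ne' t hg, hleft, hright, sub_zero, zero_add, habs]
      refine (abs_integral_kinkAntideriv_mul_le hh hB (by linarith) le_rfl le_rfl
        fun x hx => hMg x (hsub hx)).trans_eq ?_
      ring
    rw [Kde_one_eq_zero hk (by rw [abs_div, abs_of_pos hh, le_div_iff₀ hh, one_mul]; exact hfar),
      mul_zero, zero_mul, sub_zero]
    rcases le_abs.1 hfar with hl | hl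
    · exact hsmooth gm hgm hMm fun x hx => hm x (by linarith [hx.2])
    · exact hsmooth gp hgp hMp fun x hx => hp x (by linarith [hx.1])
  · rw [abs_lt] at hnear
    have hcm : Set.EqOn (fun x => kinkAntideriv k h t 0 x * gm x)
        (fun x => kinkAntideriv k h t 0 x * μ x) (Set.uIcc (t - h) lam) := fun x hx => by
      rw [Set.uIcc_of_le (by linarith)] at hx
      simp only [hm x hx.2]
    have hcp : Set.EqOn (fun x => kinkAntideriv k h t 0 x * gp x)
        (fun x => kinkAntideriv k h t 0 x * μ x) (Set.uIcc lam (t + h)) := fun x hx => by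
      rw [Set.uIcc_of_le (by linarith)] at hx
      simp only [hp x hx.1]
    have him : IntervalIntegrable (fun x => kinkAntideriv k h t 0 x * μ x) volume (t - h) lam :=
      (((continuous_kinkAntideriv k h t 0).mul hgm.continuous).intervalIntegrable _ _).congr
        (hcm.mono Set.uIoc_subset_uIcc)
    have hip : IntervalIntegrable (fun x => kinkAntideriv k h t 0 x * μ x) volume lam (t + h) :=
      (((continuous_kinkAntideriv k h t 0).mul hgp.continuous).intervalIntegrable _ _).congr
        (hcp.mono Set.uIoc_subset_uIcc)
    have hbd := kinkBoundary_sub hk h t ((hm lam le_rfl).symm.trans (hp lam le_rfl)) hhigh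
    have hK : Kde k 1 ((lam - t) / h) = Kd k 1 ((lam - t) / h) :=
      if_pos ⟨by rw [le_div_iff₀ hh]; linarith, by rw [div_le_iff₀ hh]; linarith⟩
    rw [← intervalIntegral.integral_add_adjacent_intervals him hip,
      ← intervalIntegral.integral_congr hcm, ← intervalIntegral.integral_congr hcp,
      integral_kinkAntideriv_mul k hh.ne' t hgm, integral_kinkAntideriv_mul k hh.ne' t hgp,
      hleft, hright, hK, ← hbd]
    have hEm := abs_integral_kinkAntideriv_mul_le (a := t - h) (b := lam) hh hB (by linarith) le_rfl
      (by linarith) fun x hx => hMm x (hsub ⟨hx.1, by linarith [hx.2]⟩)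
    have hEp := abs_integral_kinkAntideriv_mul_le (a := lam) (b := t + h) hh hB (by linarith)
      (by linarith) le_rfl fun x hx => hMp x (hsub ⟨by linarith [hx.1], hx.2⟩)
    rw [← habs] at hEm hEp
    refine le_trans (le_of_eq ?_) ((abs_add_le _ _).trans ((add_le_add hEm hEp).trans_eq ?_))
    · congr 1
      ring
    · ring

/-- localisation expansion of the smoothed third derivative. -/
theorem kappa_localisation (k : ℕ) (hk : 1 ≤ k) (lam : ℝ)
    (hlam : lam ∈ Set.Icc (0:ℝ) 1) (μ gm gp : ℝ → ℝ)
    (hgm : ContDiff ℝ ((2*k+1 : ℕ) : ℕ∞) gm) (hgp : ContDiff ℝ ((2*k+1 : ℕ) : ℕ∞) gp)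
    (hm : ∀ x ≤ lam, μ x = gm x) (hp : ∀ x, lam ≤ x → μ x = gp x)
    (hjump : deriv gp lam - deriv gm lam ≠ 0)
    (hhigh : ∀ i, 2 ≤ i → i ≤ 2*k → iteratedDeriv i gp lam = iteratedDeriv i gm lam) :
    ∃ C > 0, ∀ h ∈ Set.Ioo (0:ℝ) 1, ∀ t ∈ Set.Ioo h (1-h),
      (|kappah k h t μ -
        (h^2)⁻¹ * Kde k 1 ((lam - t)/h) * (deriv gp lam - deriv gm lam)| ≤ C * h^(2*k-2)) ∧
      (|lam - t| < h → |kappah k h t μ| ≤ C * (h^2)⁻¹) ∧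
      (h ≤ |lam - t| → |kappah k h t μ| ≤ C * h^(2*k-2)) := by
  obtain ⟨B, hB0, hB⟩ := exists_abs_eval_le (kinkPotential k)
  obtain ⟨B₁, hB₁0, hB₁⟩ := exists_abs_eval_le
    (Polynomial.derivative^[2 * k - 2 + 1] (kinkPotential k))
  obtain ⟨Mm, hMm⟩ := isCompact_Icc.exists_bound_of_continuousOn (s := Set.Icc (0 : ℝ) 1)
    (hgm.continuous_iteratedDeriv (2 * k + 1) le_rfl).continuousOn
  obtain ⟨Mp, hMp⟩ := isCompact_Icc.exists_bound_of_continuousOn (s := Set.Icc (0 : ℝ) 1)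
    (hgp.continuous_iteratedDeriv (2 * k + 1) le_rfl).continuousOn
  set M := max Mm Mp
  have hM0 : 0 ≤ M := (norm_nonneg _).trans ((hMm lam hlam).trans (le_max_left _ _))
  set a := deriv gp lam - deriv gm lam
  have ha : 0 < |a| := abs_pos.2 hjump
  have hC : 0 < 2 * B * M + B₁ * |a| := by positivity
  refine ⟨2 * B * M + B₁ * |a|, hC, fun h hh t ht => ?_⟩
  have hh0 : 0 < h := hh.1
  have hE : |kappah k h t μ - (h ^ 2)⁻¹ * Kde k 1 ((lam - t) / h) * a| ≤
      2 * B * M * h ^ (2 * k - 2) := by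
    have key := abs_integral_sub_le hk hgm hgp hm hp hhigh hh0 ht hB
      (fun x hx => (hMm x hx).trans (le_max_left _ _))
      (fun x hx => (hMp x hx).trans (le_max_right _ _))
    have hpow : h ^ (2 * k + 1) * h = h ^ (2 * k - 2) * h ^ 4 := by
      rw [← pow_succ, ← pow_add]
      congr 1
      lia
    rw [kappah_eq hk hh0 ht]
    refine le_trans (le_of_eq ?_) ((mul_le_mul_of_nonneg_left key
      (inv_nonneg.2 (pow_nonneg hh0.le 4))).trans_eq ?_)
    · rw [← abs_of_nonneg (inv_nonneg.2 (pow_nonneg hh0.le 4)), ← abs_mul,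
        abs_of_nonneg (inv_nonneg.2 (pow_nonneg hh0.le 4))]
      congr 1
      field_simp
      rfl
    · rw [inv_mul_eq_iff_eq_mul₀ (pow_pos hh0 4).ne']
      linear_combination 2 * B * M * hpow
  have hE' : 2 * B * M * h ^ (2 * k - 2) ≤ (2 * B * M + B₁ * |a|) * h ^ (2 * k - 2) := by
    gcongr
    exact le_add_of_nonneg_right (by positivity)
  refine ⟨hE.trans hE', fun hnear => ?_, fun hfar => ?_⟩
  · have hmem : (lam - t) / h ∈ Set.Icc (-1 : ℝ) 1 := by
      rw [abs_lt] at hnear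
      exact ⟨by rw [le_div_iff₀ hh0]; linarith, by rw [div_le_iff₀ hh0]; linarith⟩
    have hK : |Kde k 1 ((lam - t) / h)| ≤ B₁ := by
      rw [Kde, if_pos hmem, Kd_eq_eval hk]
      exact hB₁ _ hmem
    have hmain : |(h ^ 2)⁻¹ * Kde k 1 ((lam - t) / h) * a| ≤ (h ^ 2)⁻¹ * B₁ * |a| := by
      rw [abs_mul, abs_mul, abs_of_pos (inv_pos.2 (pow_pos hh0 2))]
      gcongr
    have hle : h ^ (2 * k - 2) ≤ (h ^ 2)⁻¹ :=
      (pow_le_one₀ hh0.le hh.2.le).trans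
        ((one_le_inv₀ (pow_pos hh0 2)).2 (pow_le_one₀ hh0.le hh.2.le))
    have hsplit := abs_sub_abs_le_abs_sub (kappah k h t μ)
      ((h ^ 2)⁻¹ * Kde k 1 ((lam - t) / h) * a)
    have hBM : 2 * B * M * h ^ (2 * k - 2) ≤ 2 * B * M * (h ^ 2)⁻¹ := by gcongr
    linarith
  · rw [Kde_one_eq_zero hk (by rwa [abs_div, abs_of_pos hh0, le_div_iff₀ hh0, one_mul]), mul_zero,
      zero_mul, sub_zero] at hE
    exact hE.trans hE'


end
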